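/- arXiv:2410.10495 — 2 statements merged into one kernel-verified Lean document; each statement's English description precedes it below -/
import Mathlib

section
/- Let h₁, h₂ and a family {hᵢ}_{i>2} be pairwise commuting PSD Hermitian operators with norm at most 1, and let π₁, π₂ be Hermitian projectors such that π₁ commutes with h₁ and with every hᵢ (i > 2), and π₂ commutes with h₂ and with every hᵢ (i > 2). Then tr[(π₁ − π₁ h₁ π₁)(π₂ − π₂ h₂ π₂) ∏_{i>2}(I − hᵢ)] ≥ 0. -/
open Matrix
open scoped ComplexOrder

open scoped MatrixOrder in
theorem Matrix.PosSemidef.mul_of_commute {d : Type*} [Fintype d] [DecidableEq d]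
    {A B : Matrix d d ℂ} (hA : A.PosSemidef) (hB : B.PosSemidef) (h : Commute A B) :
    (A * B).PosSemidef :=
  Matrix.nonneg_iff_posSemidef.mp
    (Commute.mul_nonneg (Matrix.nonneg_iff_posSemidef.mpr hA)
      (Matrix.nonneg_iff_posSemidef.mpr hB) h)

open scoped MatrixOrder in
theorem Matrix.PosSemidef.trace_mul_nonneg {d : Type*} [Fintype d] [DecidableEq d]
    {A B : Matrix d d ℂ} (hA : A.PosSemidef) (hB : B.PosSemidef) : 0 ≤ (A * B).trace := by
  obtain ⟨S, rfl⟩ := CStarAlgebra.nonneg_iff_eq_star_mul_self.mp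
    (Matrix.nonneg_iff_posSemidef.mpr hB)
  rw [← mul_assoc, Matrix.trace_mul_comm, ← mul_assoc]
  exact (hA.mul_mul_conjTranspose_same S).trace_nonneg

theorem Matrix.PosSemidef.list_prod_of_commute {d : Type*} [Fintype d] [DecidableEq d]
    (l : List (Matrix d d ℂ)) (hl : ∀ A ∈ l, A.PosSemidef)
    (hc : ∀ A ∈ l, ∀ B ∈ l, Commute A B) : l.prod.PosSemidef := by
  induction l with
  | nil => simpa using Matrix.PosSemidef.one
  | cons A l ih =>
    rw [List.prod_cons]
    refine (hl A (by simp)).mul_of_commute (ih (fun B hB => hl B (by simp [hB]))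
      fun B hB C hC => hc B (by simp [hB]) C (by simp [hC])) ?_
    exact Commute.list_prod_right _ _ fun B hB => hc A (by simp) B (by simp [hB])

/-- Compressing `1 - h` by a projector gives a positive semidefinite matrix. -/
theorem Matrix.PosSemidef.projector_sub {d : Type*} [Fintype d] [DecidableEq d]
    {p h : Matrix d d ℂ} (hn : (1 - h).PosSemidef) (hp : p.IsHermitian) (hpp : p * p = p) :
    (p - p * h * p).PosSemidef := by
  have key := hn.mul_mul_conjTranspose_same p
  rwa [hp.eq, mul_sub, sub_mul, mul_one, hpp] at key

/-- with `π₁` commuting with `h₁` and the rest, `π₂` commuting with `h₂` and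
the rest, the trace `tr[(π₁ − π₁h₁π₁)(π₂ − π₂h₂π₂) ∏_{i>2}(I − hᵢ)]` is nonnegative. -/
theorem projected_trace_nonneg {d : Type*} [Fintype d] [DecidableEq d]
    {m : ℕ} (h₁ h₂ : Matrix d d ℂ) (rest : Fin m → Matrix d d ℂ)
    (hh₁ : h₁.PosSemidef) (hh₂ : h₂.PosSemidef) (hrest : ∀ i, (rest i).PosSemidef)
    (hn₁ : ((1 : Matrix d d ℂ) - h₁).PosSemidef)
    (hn₂ : ((1 : Matrix d d ℂ) - h₂).PosSemidef)
    (hnrest : ∀ i, ((1 : Matrix d d ℂ) - rest i).PosSemidef)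
    (hc12 : h₁ * h₂ = h₂ * h₁)
    (hc1r : ∀ i, h₁ * rest i = rest i * h₁)
    (hc2r : ∀ i, h₂ * rest i = rest i * h₂)
    (hcrr : ∀ i j, rest i * rest j = rest j * rest i)
    (π₁ π₂ : Matrix d d ℂ)
    (hπ₁h : π₁.IsHermitian) (hπ₁i : π₁ * π₁ = π₁)
    (hπ₂h : π₂.IsHermitian) (hπ₂i : π₂ * π₂ = π₂)
    (hπ₁c : π₁ * h₁ = h₁ * π₁) (hπ₁r : ∀ i, π₁ * rest i = rest i * π₁)
    (hπ₂c : π₂ * h₂ = h₂ * π₂) (hπ₂r : ∀ i, π₂ * rest i = rest i * π₂) :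
    0 ≤ ((π₁ - π₁ * h₁ * π₁) * (π₂ - π₂ * h₂ * π₂) *
      (List.ofFn fun i => (1 : Matrix d d ℂ) - rest i).prod).trace := by
  have hR : (List.ofFn fun i => (1 : Matrix d d ℂ) - rest i).prod.PosSemidef := by
    refine Matrix.PosSemidef.list_prod_of_commute _ ?_ ?_
    · simpa [List.mem_ofFn] using hnrest
    · simp only [List.mem_ofFn]
      rintro _ ⟨i, rfl⟩ _ ⟨j, rfl⟩
      have hij : Commute (rest i) (rest j) := hcrr i j
      exact ((Commute.one_left _).sub_left ((Commute.one_right _).sub_right hij))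
  have hcomm : Commute (π₂ - π₂ * h₂ * π₂)
      (List.ofFn fun i => (1 : Matrix d d ℂ) - rest i).prod := by
    refine Commute.list_prod_right _ _ ?_
    simp only [List.mem_ofFn]
    rintro _ ⟨i, rfl⟩
    have hp : Commute π₂ (rest i) := hπ₂r i
    have hh : Commute h₂ (rest i) := hc2r i
    exact (Commute.one_right _).sub_right (hp.sub_left ((hp.mul_left hh).mul_left hp))
  rw [mul_assoc]
  exact (hn₁.projector_sub hπ₁h hπ₁i).trace_mul_nonneg
    ((hn₂.projector_sub hπ₂h hπ₂i).mul_of_commute hR hcomm)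
end

section
/- Let H = Σ_{i∈[m]} hᵢ be a commuting local Hamiltonian of PSD projectors, and let Π₁ = {π¹ₖ} and Π₂ = {π²ₗ} be two projective measurements (complete families of orthogonal projectors summing to identity). Suppose every hᵢ except possibly h₂ commutes with all elements of Π₁, every hᵢ except possibly h₁ commutes with all elements of Π₂, and hᵢ for i > 2 commute with both measurements. Then λ₀(H) = 0 if and only if there exist indices k, ℓ with tr[(π¹ₖ − π¹ₖ h₁ π¹ₖ)(π²ₗ − π²ₗ h₂ π²ₗ) ∏_{i>2}(I − hᵢ)] > 0. -/
open Matrix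
open scoped ComplexOrder

section StarProjection

variable {R : Type*} [Ring R] [StarRing R]

/-- An ordered product of pairwise commuting star projections is a star projection. -/
theorem IsStarProjection.list_prod_ofFn {m : ℕ} {f : Fin m → R}
    (hf : ∀ i, IsStarProjection (f i)) (hc : ∀ i j, Commute (f i) (f j)) :
    IsStarProjection (List.ofFn f).prod := by
  induction m with
  | zero => simp
  | succ n ih =>
    rw [List.ofFn_succ, List.prod_cons]
    refine (hf 0).mul (ih (fun i => hf _) fun i j => hc _ _) ?_
    exact Commute.list_prod_right _ _ (List.forall_mem_ofFn_iff.2 fun i => hc _ _)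

end StarProjection

theorem mul_list_prod_ofFn_one_sub_eq_zero {R : Type*} [Ring R] {m : ℕ} {f : Fin m → R}
    (hf : ∀ i, IsIdempotentElem (f i)) (hc : ∀ i j, Commute (f i) (f j)) (i : Fin m) :
    f i * (List.ofFn fun j => 1 - f j).prod = 0 := by
  induction m with
  | zero => exact i.elim0
  | succ n ih =>
    rw [List.ofFn_succ, List.prod_cons, ← mul_assoc]
    refine Fin.cases ?_ (fun j => ?_) i
    · rw [(hf 0).mul_one_sub_self, zero_mul]
    · rw [((Commute.one_right _).sub_right (hc j.succ 0)).eq, mul_assoc,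
        ih (fun i => hf _) (fun i j => hc _ _) j, mul_zero]

namespace Matrix

variable {d : Type*} [Fintype d]

theorem list_prod_ofFn_mulVec_eq_self [DecidableEq d] {m : ℕ} {f : Fin m → Matrix d d ℂ} {v : d → ℂ}
    (hv : ∀ i, f i *ᵥ v = v) : (List.ofFn f).prod *ᵥ v = v := by
  induction m with
  | zero => simp
  | succ n ih =>
    rw [List.ofFn_succ, List.prod_cons, ← mulVec_mulVec, ih fun i => hv _, hv]

theorem posSemidef_of_isStarProjection {p : Matrix d d ℂ} (hp : IsStarProjection p) :
    p.PosSemidef := by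
  have h := posSemidef_conjTranspose_mul_self p
  rwa [← star_eq_conjTranspose, hp.isSelfAdjoint.star_eq, hp.isIdempotentElem.eq] at h

/-- The trace of a product of two star projections is nonnegative. -/
theorem trace_mul_nonneg_of_isStarProjection {p q : Matrix d d ℂ} (hp : IsStarProjection p)
    (hq : IsStarProjection q) : 0 ≤ (p * q).trace := by
  have h := (posSemidef_conjTranspose_mul_self (p * q)).trace_nonneg
  rwa [← star_eq_conjTranspose, star_mul, hp.isSelfAdjoint.star_eq, hq.isSelfAdjoint.star_eq,
    mul_assoc, ← mul_assoc p, hp.isIdempotentElem.eq, trace_mul_comm, mul_assoc,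
    hq.isIdempotentElem.eq] at h

theorem trace_pos_iff_of_isStarProjection {p : Matrix d d ℂ} (hp : IsStarProjection p) :
    0 < p.trace ↔ p ≠ 0 := by
  rw [(posSemidef_of_isStarProjection hp).trace_nonneg.lt_iff_ne, ne_comm, Ne, Ne,
    (posSemidef_of_isStarProjection hp).trace_eq_zero_iff]

/-- The least eigenvalue of a positive semidefinite matrix vanishes iff its kernel is nontrivial. -/
theorem PosSemidef.iInf_eigenvalues_eq_zero_iff [DecidableEq d] [Nonempty d] {A : Matrix d d ℂ}
    (hA : A.PosSemidef) (hH : A.IsHermitian) :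
    (⨅ j, hH.eigenvalues j) = 0 ↔ ∃ v, v ≠ 0 ∧ A *ᵥ v = 0 := by
  have hnn : ∀ j, 0 ≤ hH.eigenvalues j := hA.eigenvalues_nonneg
  rw [exists_mulVec_eq_zero_iff, hH.det_eq_prod_eigenvalues, Finset.prod_eq_zero_iff]
  constructor
  · intro h
    obtain ⟨j, hj⟩ := exists_eq_ciInf_of_finite (f := hH.eigenvalues)
    exact ⟨j, Finset.mem_univ _, by rw [hj, h]; simp⟩
  · rintro ⟨j, -, hj⟩
    refine le_antisymm ?_ (le_ciInf hnn)
    exact (ciInf_le (Set.finite_range _).bddBelow j).trans (RCLike.ofReal_eq_zero.1 hj).le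

theorem PosSemidef.add_mulVec_eq_zero_iff {A B : Matrix d d ℂ} (hA : A.PosSemidef)
    (hB : B.PosSemidef) {v : d → ℂ} : (A + B) *ᵥ v = 0 ↔ A *ᵥ v = 0 ∧ B *ᵥ v = 0 := by
  rw [← (hA.add hB).dotProduct_mulVec_zero_iff, ← hA.dotProduct_mulVec_zero_iff,
    ← hB.dotProduct_mulVec_zero_iff, add_mulVec, dotProduct_add,
    add_eq_zero_iff_of_nonneg (hA.dotProduct_mulVec_nonneg v) (hB.dotProduct_mulVec_nonneg v)]

theorem PosSemidef.sum_mulVec_eq_zero_iff {ι : Type*} [Fintype ι] {A : ι → Matrix d d ℂ}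
    (hA : ∀ i, (A i).PosSemidef) {v : d → ℂ} : (∑ i, A i) *ᵥ v = 0 ↔ ∀ i, A i *ᵥ v = 0 := by
  rw [← (posSemidef_sum _ fun i _ => hA i).dotProduct_mulVec_zero_iff, sum_mulVec,
    dotProduct_sum, Finset.sum_eq_zero_iff_of_nonneg fun i _ => (hA i).dotProduct_mulVec_nonneg v]
  simp [(hA _).dotProduct_mulVec_zero_iff]

/-- For commuting projections, the least eigenvalue of their sum is zero iff the product of their
complements does not vanish. -/
theorem iInf_eigenvalues_eq_zero_iff_prod_one_sub_ne_zero [DecidableEq d] [Nonempty d] {m : ℕ}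
    {h₁ h₂ : Matrix d d ℂ} {rest : Fin m → Matrix d d ℂ}
    (hh₁ : IsStarProjection h₁) (hh₂ : IsStarProjection h₂)
    (hr : ∀ i, IsStarProjection (rest i))
    (hc12 : Commute h₁ h₂) (hc1r : ∀ i, Commute h₁ (rest i)) (hc2r : ∀ i, Commute h₂ (rest i))
    (hcrr : ∀ i j, Commute (rest i) (rest j))
    (hH : (h₁ + h₂ + ∑ i, rest i).IsHermitian) :
    (⨅ j, hH.eigenvalues j) = 0 ↔
      (1 - h₁) * (1 - h₂) * (List.ofFn fun i => 1 - rest i).prod ≠ 0 := by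
  have p₁ := posSemidef_of_isStarProjection hh₁
  have p₂ := posSemidef_of_isStarProjection hh₂
  have pr := fun i => posSemidef_of_isStarProjection (hr i)
  have ps := posSemidef_sum Finset.univ fun i _ => pr i
  rw [((p₁.add p₂).add ps).iInf_eigenvalues_eq_zero_iff hH]
  simp only [(p₁.add p₂).add_mulVec_eq_zero_iff ps, p₁.add_mulVec_eq_zero_iff p₂,
    PosSemidef.sum_mulVec_eq_zero_iff pr]
  constructor
  · rintro ⟨v, hv, ⟨h1, h2⟩, h3⟩ h0
    apply hv
    have hP : (List.ofFn fun i => 1 - rest i).prod *ᵥ v = v :=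
      list_prod_ofFn_mulVec_eq_self fun i => by rw [sub_mulVec, h3, one_mulVec, sub_zero]
    rw [← zero_mulVec v, ← h0, ← mulVec_mulVec, ← mulVec_mulVec, hP]
    simp [sub_mulVec, h1, h2]
  · intro h0
    obtain ⟨w, hw⟩ : ∃ w,
        ((1 - h₁) * (1 - h₂) * (List.ofFn fun i => 1 - rest i).prod) *ᵥ w ≠ 0 := by
      by_contra! hcon
      exact h0 (ext_of_mulVec_single fun i => by rw [hcon, zero_mulVec])
    refine ⟨_, hw, ⟨?_, ?_⟩, fun i => ?_⟩
    · rw [mulVec_mulVec, ← mul_assoc, ← mul_assoc, hh₁.isIdempotentElem.mul_one_sub_self,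
        zero_mul, zero_mul, zero_mulVec]
    · rw [mulVec_mulVec, ← mul_assoc, ← mul_assoc,
        ((Commute.one_right h₂).sub_right hc12.symm).eq, mul_assoc (1 - h₁),
        hh₂.isIdempotentElem.mul_one_sub_self, mul_zero, zero_mul, zero_mulVec]
    · have hc : Commute (rest i) ((1 - h₁) * (1 - h₂)) :=
        ((Commute.one_right _).sub_right (hc1r i).symm).mul_right
          ((Commute.one_right _).sub_right (hc2r i).symm)
      rw [mulVec_mulVec, ← mul_assoc, hc.eq, mul_assoc,
        mul_list_prod_ofFn_one_sub_eq_zero (fun i => (hr i).isIdempotentElem) hcrr, mul_zero,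
        zero_mulVec]

end Matrix

/-- equivalence under a pair of projective measurements: `λ₀(H) = 0` iff
there are outcomes `k, ℓ` with
`tr[(π¹ₖ − π¹ₖ h₁ π¹ₖ)(π²ₗ − π²ₗ h₂ π²ₗ) ∏_{i>2}(I − hᵢ)] > 0`. -/
theorem equiv_under_projectors {d : Type*} [Fintype d] [DecidableEq d] [Nonempty d]
    {m : ℕ} {κ₁ κ₂ : Type*} [Fintype κ₁] [Fintype κ₂]
    (h₁ h₂ : Matrix d d ℂ) (rest : Fin m → Matrix d d ℂ)
    -- all terms are Hermitian projectors
    (hh₁ : h₁.IsHermitian) (hh₁i : h₁ * h₁ = h₁)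
    (hh₂ : h₂.IsHermitian) (hh₂i : h₂ * h₂ = h₂)
    (hr : ∀ i, (rest i).IsHermitian) (hri : ∀ i, rest i * rest i = rest i)
    -- pairwise commuting
    (hc12 : h₁ * h₂ = h₂ * h₁)
    (hc1r : ∀ i, h₁ * rest i = rest i * h₁)
    (hc2r : ∀ i, h₂ * rest i = rest i * h₂)
    (hcrr : ∀ i j, rest i * rest j = rest j * rest i)
    -- Π₁ and Π₂ are projective measurements
    (π₁ : κ₁ → Matrix d d ℂ) (π₂ : κ₂ → Matrix d d ℂ)
    (hπ₁h : ∀ k, (π₁ k).IsHermitian) (hπ₁i : ∀ k, π₁ k * π₁ k = π₁ k)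
    (hπ₁o : ∀ k k', k ≠ k' → π₁ k * π₁ k' = 0) (hπ₁s : ∑ k, π₁ k = 1)
    (hπ₂h : ∀ l, (π₂ l).IsHermitian) (hπ₂i : ∀ l, π₂ l * π₂ l = π₂ l)
    (hπ₂o : ∀ l l', l ≠ l' → π₂ l * π₂ l' = 0) (hπ₂s : ∑ l, π₂ l = 1)
    -- every term except possibly h₂ commutes with Π₁; except possibly h₁ with Π₂
    (hπ₁c : ∀ k, π₁ k * h₁ = h₁ * π₁ k) (hπ₁r : ∀ k i, π₁ k * rest i = rest i * π₁ k)
    (hπ₂c : ∀ l, π₂ l * h₂ = h₂ * π₂ l) (hπ₂r : ∀ l i, π₂ l * rest i = rest i * π₂ l)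
    (hH : (h₁ + h₂ + ∑ i, rest i).IsHermitian) :
    (⨅ j, hH.eigenvalues j) = 0 ↔
      ∃ (k : κ₁) (l : κ₂),
        0 < ((π₁ k - π₁ k * h₁ * π₁ k) * (π₂ l - π₂ l * h₂ * π₂ l) *
          (List.ofFn fun i => (1 : Matrix d d ℂ) - rest i).prod).trace := by
  have s₁ : IsStarProjection h₁ := ⟨hh₁i, hh₁⟩
  have s₂ : IsStarProjection h₂ := ⟨hh₂i, hh₂⟩
  have sr : ∀ i, IsStarProjection (rest i) := fun i => ⟨hri i, hr i⟩
  rw [iInf_eigenvalues_eq_zero_iff_prod_one_sub_ne_zero s₁ s₂ sr hc12 hc1r hc2r hcrr hH]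
  set P := (List.ofFn fun i => (1 : Matrix d d ℂ) - rest i).prod with hP
  have sP : IsStarProjection P := IsStarProjection.list_prod_ofFn (fun i => (sr i).one_sub)
    fun i j => (Commute.one_left _).sub_left ((Commute.one_right _).sub_right (hcrr i j))
  have commP : ∀ x, (∀ i, Commute x (rest i)) → Commute x P := fun x hx =>
    Commute.list_prod_right _ _
      (List.forall_mem_ofFn_iff.2 fun i => (Commute.one_right _).sub_right (hx i))
  have c₁ : ∀ k, Commute (π₁ k) (1 - h₁) := fun k => (Commute.one_right _).sub_right (hπ₁c k)
  have c₂ : ∀ l, Commute (π₂ l) (1 - h₂) := fun l => (Commute.one_right _).sub_right (hπ₂c l)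
  have e₁ : ∀ k, π₁ k - π₁ k * h₁ * π₁ k = π₁ k * (1 - h₁) := fun k => by
    rw [mul_assoc, ← hπ₁c, ← mul_assoc, hπ₁i, mul_sub, mul_one]
  have e₂ : ∀ l, π₂ l - π₂ l * h₂ * π₂ l = π₂ l * (1 - h₂) := fun l => by
    rw [mul_assoc, ← hπ₂c, ← mul_assoc, hπ₂i, mul_sub, mul_one]
  have c12 : Commute (1 - h₁) (1 - h₂) :=
    (Commute.one_left _).sub_left ((Commute.one_right _).sub_right hc12)
  have c1P : Commute (1 - h₁) P := (Commute.one_left _).sub_left (commP _ hc1r)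
  have c2P : Commute (1 - h₂) P := (Commute.one_left _).sub_left (commP _ hc2r)
  have sQ : IsStarProjection ((1 - h₁) * (1 - h₂) * P) :=
    (s₁.one_sub.mul s₂.one_sub c12).mul sP (c1P.mul_left c2P)
  have hnn : ∀ k l, 0 ≤ (π₁ k * (1 - h₁) * (π₂ l * (1 - h₂)) * P).trace := fun k l => by
    rw [mul_assoc]
    refine trace_mul_nonneg_of_isStarProjection
      (IsStarProjection.mul ⟨hπ₁i k, hπ₁h k⟩ s₁.one_sub (c₁ k)) ?_
    exact (IsStarProjection.mul ⟨hπ₂i l, hπ₂h l⟩ s₂.one_sub (c₂ l)).mul sP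
      ((commP _ (hπ₂r l)).mul_left c2P)
  have hsum : ((1 - h₁) * (1 - h₂) * P).trace =
      ∑ k, ∑ l, (π₁ k * (1 - h₁) * (π₂ l * (1 - h₂)) * P).trace := by
    simp only [← trace_sum, ← Finset.sum_mul, ← Finset.mul_sum, hπ₁s, hπ₂s, one_mul]
  simp only [e₁, e₂]
  rw [← trace_pos_iff_of_isStarProjection sQ, hsum,
    Finset.sum_pos_iff_of_nonneg fun k _ => Finset.sum_nonneg fun l _ => hnn k l]
  simp only [Finset.mem_univ, true_and, Finset.sum_pos_iff_of_nonneg fun l _ => hnn _ l]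
end
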